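/- Let N ≥ 2 and j ∈ {1,…,2N−1}. For every α ∈ LP_N with {j,j+1} ∈ α, there exists β ∈ LP_N such that {j,j+1} ∉ β and M_{α,β} = 1. -/

import Mathlib

open MeasureTheory

/-- A planar link pattern of size `N`: a noncrossing perfect matching of `{1,…,2N}`,
with the links `{a r, b r}` satisfying `a r < b r` and `a` strictly increasing. -/
structure LinkPattern (N : ℕ) where
  a : Fin N → ℕ
  b : Fin N → ℕ
  a_lt_b : ∀ r, a r < b r
  a_mono : StrictMono a
  inj : Function.Injective (fun p : Fin N × Bool => if p.2 then b p.1 else a p.1)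
  cover : ∀ k : ℕ, (∃ p : Fin N × Bool, (if p.2 then b p.1 else a p.1) = k) ↔ (1 ≤ k ∧ k ≤ 2 * N)
  noncross : ∀ r s : Fin N, ¬ (a r < a s ∧ a s < b r ∧ b r < b s)

/-- The (unordered) link relation of a link pattern. -/
def LinkPattern.Linked {N : ℕ} (β : LinkPattern N) (p q : ℕ) : Prop :=
  ∃ r, (β.a r = p ∧ β.b r = q) ∨ (β.a r = q ∧ β.b r = p)

/-- The positive real integral `ρ_{k_1,…,k_N}(x)`. -/
noncomputable def rho (N : ℕ) (k : Fin N → ℕ) (x : ℕ → ℝ) : ℝ :=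
  (∏ p ∈ (Finset.Icc 1 (2 * N) ×ˢ Finset.Icc 1 (2 * N)).filter fun p => p.1 < p.2,
      (x p.2 - x p.1) ^ ((4 : ℝ)⁻¹)) *
  ∫ u : Fin N → ℝ in Set.univ.pi fun r => Set.Ioo (x (k r)) (x (k r + 1)),
    (∏ p ∈ (Finset.univ ×ˢ Finset.univ : Finset (Fin N × Fin N)).filter fun p => p.1 < p.2,
        (u p.2 - u p.1)) *
      ∏ r, ∏ i ∈ Finset.Icc 1 (2 * N), |u r - x i| ^ (-(2 : ℝ)⁻¹)

/-- The coefficient `c_β(k_1,…,k_N)`. -/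
noncomputable def linkCoeff (N : ℕ) (β : LinkPattern N) (k : Fin N → ℕ) : ℂ :=
  Complex.I ^ ((∑ r, (k r : ℤ)) - ∑ r, (β.a r : ℤ)) *
    ∑ σ : Equiv.Perm (Fin N),
      ((Equiv.Perm.sign σ : ℤ) : ℂ) *
        ∏ r, if β.a r ≤ k (σ r) ∧ k (σ r) < β.b r then (1 : ℂ) else 0

/-- The Coulomb gas integral `F_β(x)`. -/
noncomputable def coulomb (N : ℕ) (β : LinkPattern N) (x : ℕ → ℝ) : ℂ :=
  ∑ k ∈ (Fintype.piFinset fun _ : Fin N => Finset.Icc 1 (2 * N - 1)).filter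
      fun k => ∀ r s : Fin N, r < s → k r < k s,
    linkCoeff N β k * (rho N k x : ℂ)

/-- Membership in the open chamber `𝔛_{2N}` (only coordinates `1,…,2N` are relevant). -/
def IsChamber (N : ℕ) (x : ℕ → ℝ) : Prop :=
  ∀ i k : ℕ, 1 ≤ i → i < k → k ≤ 2 * N → x i < x k

/-- The meander matrix entry `M_{α,β}` equals `1`, i.e. the graph on `{1,…,2N}` with edge set
`α ∪ β` is connected. -/
def MeanderOne (N : ℕ) (α β : LinkPattern N) : Prop :=
  ∀ p q : ℕ, 1 ≤ p → p ≤ 2 * N → 1 ≤ q → q ≤ 2 * N →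
    Relation.ReflTransGen (fun u v => α.Linked u v ∨ β.Linked u v) p q

/-- `f` restricts to a noncrossing fixed-point-free involution of `S`. -/
structure IsPlanarMatching (S : Finset ℕ) (f : ℕ → ℕ) : Prop where
  mem : ∀ x ∈ S, f x ∈ S
  invol : ∀ x ∈ S, f (f x) = x
  ne : ∀ x ∈ S, f x ≠ x
  noncross : ∀ x ∈ S, ∀ y ∈ S, ¬ (x < y ∧ y < f x ∧ f x < f y)

/-- The union of the matchings `f` and `g` is connected on `S`. -/
def JoinConnected (S : Finset ℕ) (f g : ℕ → ℕ) : Prop :=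
  ∀ E : ℕ → ℕ → Prop, Equivalence E → (∀ u ∈ S, E u (f u) ∧ E u (g u)) →
    ∀ x ∈ S, ∀ y ∈ S, E x y

namespace IsPlanarMatching

variable {S : Finset ℕ} {f g : ℕ → ℕ}

/-- A nonempty matching has a last opening point, and it is linked to its successor. -/
theorem exists_last_opener (hf : IsPlanarMatching S f) (hS : S.Nonempty) :
    ∃ i ∈ S, i < f i ∧ (∀ x ∈ S, x < f x → x ≤ i) ∧ ∀ x ∈ S, ¬ (i < x ∧ x < f i) := by
  obtain ⟨s, hs⟩ := hS
  have hne : (S.filter fun x => x < f x).Nonempty := by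
    rcases lt_or_gt_of_ne (hf.ne s hs) with h | h
    · exact ⟨f s, by simp [hf.mem s hs, hf.invol s hs, h]⟩
    · exact ⟨s, by simp [hs, h]⟩
  obtain ⟨i, hi, hmax⟩ := Finset.exists_max_image _ id hne
  simp only [Finset.mem_filter, id] at hi hmax
  refine ⟨i, hi.1, hi.2, fun x hx h => hmax x ⟨hx, h⟩, fun x hx h => ?_⟩
  have h1 := hmax x
  have h2 := hmax (f x)
  have := hf.mem x hx
  have := hf.invol x hx
  have := hf.ne x hx
  have := hf.noncross (f x) (hf.mem x hx) i hi.1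
  have := hf.invol i hi.1
  have : f x ≠ i := fun e => by grind
  grind

theorem erase_link (hf : IsPlanarMatching S f) {i : ℕ} (hi : i ∈ S) :
    IsPlanarMatching ((S.erase i).erase (f i)) f := by
  obtain ⟨h1, h2, h3, h4⟩ := hf
  constructor <;> grind

/-- Insert the link `{p, i}` and replace the endpoint `p` of its old link by `j`. -/
def insertLink (g : ℕ → ℕ) (p i j x : ℕ) : ℕ :=
  if x = p then i else if x = i then p else if x = j then g p else if x = g p then j else g x

theorem insertLink_isPlanarMatching {p i j : ℕ} (hi : i ∈ S) (hj : j ∈ S) (hp : p ∈ S)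
    (hpi : p < i) (hij : i < j) (hgap : ∀ x ∈ S, ¬ (i < x ∧ x < j))
    (hgap' : ∀ x ∈ S, ¬ (p < x ∧ x < i))
    (hg : IsPlanarMatching ((S.erase i).erase j) g) :
    IsPlanarMatching S (insertLink g p i j) := by
  obtain ⟨h1, h2, h3, h4⟩ := hg
  simp only [Finset.mem_erase] at h1 h2 h3 h4
  have hp' : p ≠ j ∧ p ≠ i ∧ p ∈ S := ⟨by omega, by omega, hp⟩
  have q1 := h1 p hp'
  have q2 := h2 p hp'
  have q3 := h3 p hp'
  unfold insertLink
  constructor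
  · grind
  · intro x hx
    grind
  · grind
  · intro x hx y hy
    have a1 := hgap x hx
    have a2 := hgap' x hx
    have a3 := hgap y hy
    have a4 := hgap' y hy
    have a5 := hgap _ q1.2.2
    have a6 := hgap' _ q1.2.2
    have b1 := h4 x
    have b2 := h4 p hp' y
    have b3 := h4 (g p) q1 y
    have b4 := fun h => b1 h p hp'
    have b5 := fun h => b1 h (g p) q1
    have b6 := fun h => b1 h y
    have c1 := h1 x
    have c2 := h1 y
    have d1 := hgap (g x)
    have d2 := hgap' (g x)
    have d3 := hgap (g y)
    have d4 := hgap' (g y)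
    have e1 := h2 x
    have e2 := h2 y
    clear h1 h2 h3 h4 hgap hgap' b1
    grind

theorem joinConnected_insertLink {p i : ℕ} (hi : i ∈ S) (hp : p ∈ S)
    (hpi : p ≠ i) (hpj : p ≠ f i) (hij : i ≠ f i) (hj : f i ∈ S)
    (hg : IsPlanarMatching ((S.erase i).erase (f i)) g)
    (hc : JoinConnected ((S.erase i).erase (f i)) f g) :
    JoinConnected S f (insertLink g p i (f i)) := by
  intro E hE h
  have hp' : p ∈ (S.erase i).erase (f i) := by grind
  have q1 := hg.mem p hp'
  have q2 := hg.invol p hp'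
  have pi : E p i := by simpa [insertLink] using (h p hp).2
  have ij : E i (f i) := (h i hi).1
  have jq : E (f i) (g p) := by
    simpa [insertLink, hpj.symm, hij.symm] using (h (f i) hj).2
  have pq : E p (g p) := hE.trans pi (hE.trans ij jq)
  have key := hc E hE fun u hu => by
    have hu' : u ∈ S := by grind
    refine ⟨(h u hu').1, ?_⟩
    by_cases h1 : u = p
    · exact h1 ▸ pq
    by_cases h2 : u = g p
    · rw [h2, q2]; exact hE.symm pq
    have := (h u hu').2
    have h3 : u ≠ i ∧ u ≠ f i := by grind
    simpa [insertLink, h1, h2, h3.1, h3.2] using this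
  have hall : ∀ x ∈ S, E x p := fun x hx => by
    by_cases h1 : x = i
    · exact h1 ▸ hE.symm pi
    by_cases h2 : x = f i
    · exact h2 ▸ hE.symm (hE.trans pi ij)
    exact key x (by grind) p hp'
  exact fun x hx y hy => hE.trans (hall x hx) (hE.symm (hall y hy))

/-- Every planar matching has a planar matching with which it forms a single loop. -/
theorem exists_joinConnected (S : Finset ℕ) (f : ℕ → ℕ) (hf : IsPlanarMatching S f) :
    ∃ g, IsPlanarMatching S g ∧ JoinConnected S f g := by
  induction S using Finset.strongInduction with
  | H S ih =>
    rcases S.eq_empty_or_nonempty with rfl | hS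
    · exact ⟨f, hf, fun E _ _ x hx => by simp at hx⟩
    obtain ⟨i, hi, hij, hmax, hgap⟩ := hf.exists_last_opener hS
    have hj := hf.mem i hi
    by_cases hT : ((S.erase i).erase (f i)).Nonempty
    · obtain ⟨g, hg, hc⟩ := ih _ (Finset.ssubset_of_subset_of_ssubset
        (Finset.erase_subset _ _) (Finset.erase_ssubset hi)) (hf.erase_link hi)
      obtain ⟨k, hk, hkf, -⟩ := (hf.erase_link hi).exists_last_opener hT
      have hkS : k ∈ S ∧ k ≠ i := by grind
      have hki := hmax k hkS.1 hkf
      obtain ⟨p, hp, hpmax⟩ := Finset.exists_max_image (S.filter (· < i)) id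
        ⟨k, by simp; grind⟩
      simp only [Finset.mem_filter, id] at hp hpmax
      have hgap' : ∀ x ∈ S, ¬ (p < x ∧ x < i) := fun x hx h => by
        have := hpmax x ⟨hx, h.2⟩
        omega
      exact ⟨_, insertLink_isPlanarMatching hi hj hp.1 hp.2 hij hgap hgap' hg,
        joinConnected_insertLink hi hp.1 (by omega) (by omega) (by omega) hj hg hc⟩
    · refine ⟨f, hf, fun E hE h => ?_⟩
      have hall : ∀ x ∈ S, E i x := fun x hx => by
        by_cases h1 : x = i
        · exact h1 ▸ hE.refl _
        by_cases h2 : x = f i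
        · exact h2 ▸ (h i hi).1
        exact absurd ⟨x, by grind⟩ hT
      exact fun x hx y hy => hE.trans (hE.symm (hall x hx)) (hall y hy)

theorem card_openers (hf : IsPlanarMatching S f) :
    2 * (S.filter fun x => x < f x).card = S.card := by
  have h1 : (S.filter fun x => x < f x).card = (S.filter fun x => ¬ x < f x).card := by
    obtain ⟨h1, h2, h3, -⟩ := hf
    refine Finset.card_bij' (fun x _ => f x) (fun x _ => f x) ?_ ?_ ?_ ?_ <;> grind
  have h2 := Finset.card_filter_add_card_filter_not (s := S) (fun x => x < f x)
  omega

/-- A planar matching of `{1,…,2N}` is the matching of a link pattern. -/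
theorem exists_linkPattern {N : ℕ} (hf : IsPlanarMatching (Finset.Icc 1 (2 * N)) f) :
    ∃ β : LinkPattern N, ∀ x ∈ Finset.Icc 1 (2 * N), β.Linked x (f x) := by
  set O := (Finset.Icc 1 (2 * N)).filter fun x => x < f x with hO
  have hcard : O.card = N := by
    have : 2 * O.card = (Finset.Icc 1 (2 * N)).card := hf.card_openers
    rw [Nat.card_Icc] at this
    omega
  set a := O.orderEmbOfFin hcard
  have ha : ∀ r, a r ∈ Finset.Icc 1 (2 * N) ∧ a r < f (a r) := fun r => by
    simpa only [hO, Finset.mem_filter] using O.orderEmbOfFin_mem hcard r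
  have hsurj : ∀ x ∈ Finset.Icc 1 (2 * N), x < f x → ∃ r, a r = x := fun x hx h => by
    have : x ∈ Set.range (O.orderEmbOfFin hcard) := by
      rw [Finset.range_orderEmbOfFin]
      simp only [hO, Finset.coe_filter, Set.mem_ofPred_eq]
      exact ⟨hx, h⟩
    exact this
  have hfinj : ∀ r s, f (a r) = f (a s) → r = s := fun r s h => by
    have := congrArg f h
    rw [hf.invol _ (ha r).1, hf.invol _ (ha s).1] at this
    exact a.injective this
  have hab : ∀ r s, a r ≠ f (a s) := fun r s h => by
    have h1 := (ha r).2
    rw [h, hf.invol _ (ha s).1] at h1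
    exact absurd (ha s).2 (by omega)
  have hclose : ∀ x ∈ Finset.Icc 1 (2 * N), ¬ x < f x → ∃ r, a r = f x := fun x hx h =>
    hsurj _ (hf.mem x hx) (by
      have := hf.ne x hx
      rw [hf.invol x hx]
      omega)
  refine ⟨⟨a, fun r => f (a r), fun r => (ha r).2, a.strictMono, ?_, ?_, ?_⟩, ?_⟩
  · rintro ⟨r, _ | _⟩ ⟨s, _ | _⟩ h <;> simp at h
    · simp [h]
    · exact absurd h (hab r s)
    · exact absurd h.symm (hab s r)
    · simp [hfinj r s h]
  · intro k
    rw [← Finset.mem_Icc]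
    constructor
    · rintro ⟨⟨r, _ | _⟩, rfl⟩
      · exact (ha r).1
      · exact hf.mem _ (ha r).1
    · intro hk
      by_cases h : k < f k
      · obtain ⟨r, hr⟩ := hsurj k hk h
        exact ⟨(r, false), by simpa using hr⟩
      · obtain ⟨r, hr⟩ := hclose k hk h
        exact ⟨(r, true), by simp [hr, hf.invol k hk]⟩
  · exact fun r s => hf.noncross _ (ha r).1 _ (ha s).1
  · intro x hx
    by_cases h : x < f x
    · obtain ⟨r, hr⟩ := hsurj x hx h
      exact ⟨r, Or.inl ⟨hr, congrArg f hr⟩⟩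
    · obtain ⟨r, hr⟩ := hclose x hx h
      exact ⟨r, Or.inr ⟨hr, (congrArg f hr).trans (hf.invol x hx)⟩⟩

end IsPlanarMatching

namespace LinkPattern

variable {N : ℕ} (β : LinkPattern N)

theorem Linked.symm {β : LinkPattern N} {p q : ℕ} (h : β.Linked p q) : β.Linked q p := by
  obtain ⟨r, h⟩ := h
  exact ⟨r, h.symm⟩

theorem Linked.unique {β : LinkPattern N} {p q q' : ℕ} (h : β.Linked p q)
    (h' : β.Linked p q') : q = q' := by
  obtain ⟨r, h⟩ := h
  obtain ⟨s, h'⟩ := h'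
  rcases h with ⟨h1, h2⟩ | ⟨h1, h2⟩ <;> rcases h' with ⟨h3, h4⟩ | ⟨h3, h4⟩
  · have := @β.inj (r, false) (s, false) (by simp [h1, h3])
    grind
  · have := @β.inj (r, false) (s, true) (by simp [h1, h4])
    grind
  · have := @β.inj (r, true) (s, false) (by simp [h2, h3])
    grind
  · have := @β.inj (r, true) (s, true) (by simp [h2, h4])
    grind

theorem Linked.mem_Icc {β : LinkPattern N} {p q : ℕ} (h : β.Linked p q) :
    p ∈ Finset.Icc 1 (2 * N) := by
  rw [Finset.mem_Icc, ← β.cover]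
  obtain ⟨r, ⟨h, -⟩ | ⟨-, h⟩⟩ := h
  · exact ⟨(r, false), by simpa using h⟩
  · exact ⟨(r, true), by simpa using h⟩

theorem Linked.eq_of_lt {β : LinkPattern N} {p q : ℕ} (h : β.Linked p q) (hpq : p < q) :
    ∃ r, β.a r = p ∧ β.b r = q := by
  obtain ⟨r, h | ⟨h1, h2⟩⟩ := h
  · exact ⟨r, h⟩
  · have := β.a_lt_b r
    omega

/-- Every link pattern is the graph of a planar matching of `{1,…,2N}`. -/
theorem exists_isPlanarMatching :
    ∃ f, IsPlanarMatching (Finset.Icc 1 (2 * N)) f ∧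
      ∀ x ∈ Finset.Icc 1 (2 * N), β.Linked x (f x) := by
  have hex : ∀ x, ∃ y, x ∈ Finset.Icc 1 (2 * N) → β.Linked x y := fun x => by
    by_cases hx : x ∈ Finset.Icc 1 (2 * N)
    · obtain ⟨⟨r, _ | _⟩, h⟩ := (β.cover x).2 (Finset.mem_Icc.1 hx)
      · exact ⟨β.b r, fun _ => ⟨r, Or.inl ⟨by simpa using h, rfl⟩⟩⟩
      · exact ⟨β.a r, fun _ => ⟨r, Or.inr ⟨rfl, by simpa using h⟩⟩⟩
    · exact ⟨0, fun h => absurd h hx⟩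
  choose f hf using hex
  have hmem : ∀ x ∈ Finset.Icc 1 (2 * N), f x ∈ Finset.Icc 1 (2 * N) :=
    fun x hx => (hf x hx).symm.mem_Icc
  refine ⟨f, ⟨hmem, fun x hx => (hf _ (hmem x hx)).unique (hf x hx).symm, ?_, ?_⟩, hf⟩
  · intro x hx h
    obtain ⟨r, h'⟩ := hf x hx
    have := β.a_lt_b r
    omega
  · rintro x hx y hy ⟨h1, h2, h3⟩
    obtain ⟨r, hr, hr'⟩ := (hf x hx).eq_of_lt (h1.trans h2)
    obtain ⟨s, hs, hs'⟩ := (hf y hy).eq_of_lt (h2.trans h3)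
    exact β.noncross r s (by omega)

/-- Every link pattern forms a one-loop meander with some link pattern. -/
theorem exists_meanderOne (α : LinkPattern N) : ∃ β : LinkPattern N, MeanderOne N α β := by
  obtain ⟨f, hf, hα⟩ := α.exists_isPlanarMatching
  obtain ⟨g, hg, hc⟩ := IsPlanarMatching.exists_joinConnected _ f hf
  obtain ⟨β, hβ⟩ := hg.exists_linkPattern
  refine ⟨β, fun p q hp hp' hq hq' => ?_⟩
  have hsymm : Std.Symm fun u v => α.Linked u v ∨ β.Linked u v :=
    ⟨fun u v h => h.imp Linked.symm Linked.symm⟩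
  exact hc (Relation.ReflTransGen fun u v => α.Linked u v ∨ β.Linked u v)
    ⟨fun _ => .refl, fun h => Relation.ReflTransGen.stdSymm.symm _ _ h, fun h h' => h.trans h'⟩
    (fun u hu => ⟨.single (Or.inl (hα u hu)), .single (Or.inr (hβ u hu))⟩)
    p (Finset.mem_Icc.2 ⟨hp, hp'⟩) q (Finset.mem_Icc.2 ⟨hq, hq'⟩)

/-- Patterns of size at least two forming a one-loop meander share no link. -/
theorem not_linked_of_meanderOne (hN : 2 ≤ N) {α β : LinkPattern N} (h : MeanderOne N α β)
    {p q : ℕ} (hα : α.Linked p q) : ¬ β.Linked p q := by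
  intro hβ
  have hp := Finset.mem_Icc.1 hα.mem_Icc
  have closed : ∀ z, Relation.ReflTransGen (fun u v => α.Linked u v ∨ β.Linked u v) p z →
      z = p ∨ z = q := fun z hz => by
    induction hz with
    | refl => exact Or.inl rfl
    | tail _ hstep ih =>
      rcases ih with rfl | rfl <;> rcases hstep with hs | hs
      · exact Or.inr (hs.unique hα)
      · exact Or.inr (hs.unique hβ)
      · exact Or.inl (hs.unique hα.symm)
      · exact Or.inl (hs.unique hβ.symm)
  have h1 := closed 1 (h p 1 hp.1 hp.2 (by omega) (by omega))
  have h2 := closed 2 (h p 2 hp.1 hp.2 (by omega) (by omega))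
  have h3 := closed 3 (h p 3 hp.1 hp.2 (by omega) (by omega))
  omega

end LinkPattern

/-- **Lemma 5.5(2).** For every `α ∈ LP_N` with `{j,j+1} ∈ α` there is `β ∈ LP_N` with
`{j,j+1} ∉ β` and `M_{α,β} = 1`. -/
theorem exists_meander_one_without_link (N : ℕ) (hN : 2 ≤ N) (j : ℕ)
    (hj1 : 1 ≤ j) (hj2 : j ≤ 2 * N - 1)
    (α : LinkPattern N) (hα : α.Linked j (j + 1)) :
    ∃ β : LinkPattern N, ¬ β.Linked j (j + 1) ∧ MeanderOne N α β := by
  obtain ⟨β, hβ⟩ := α.exists_meanderOne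
  exact ⟨β, LinkPattern.not_linked_of_meanderOne hN hβ hα, hβ⟩
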